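/- Let x and w be independent Gaussian random vectors on ℝ^d with x ∼ N(μ, C_data) (C_data symmetric positive definite) and w ∼ N(0, I_d), and let σ > 0. Set z := (x + σw, 1) ∈ ℝ^{d+1}, y := −w/σ ∈ ℝ^d, C_z := E[z zᵀ], ν_i := E[y_i z] (so ν_i = −(e_i, 0)), θ_i* := C_z^{-1} ν_i, and C_σ := C_data + σ² I. Then for all 1 ≤ i, j ≤ d, the matrix Σ_ε^{ij} := E[y_i y_j z zᵀ] + E[z zᵀ θ_i* (θ_j*)ᵀ z zᵀ] − E[y_i (θ_j*)ᵀz · z zᵀ] − E[y_j (θ_i*)ᵀz · z zᵀ] satisfies Σ_ε^{ij} = (1/σ²) (C_σ^{-1} C_data)_{ij} · C_z. -/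

import Mathlib

open Matrix MeasureTheory ProbabilityTheory

/-- A random vector `X` is Gaussian with mean `μ` and covariance `C` iff every linear
functional of `X` is (one-dimensional) Gaussian with the corresponding parameters. -/
def IsGaussianVec {Ω : Type*} [MeasurableSpace Ω] (P : Measure Ω) {d : ℕ}
    (X : Ω → Fin d → ℝ) (μ : Fin d → ℝ) (C : Matrix (Fin d) (Fin d) ℝ) : Prop :=
  Measurable X ∧ ∀ a : Fin d → ℝ,
    Measure.map (fun ω => ∑ i, a i * X ω i) P =
      gaussianReal (∑ i, a i * μ i) (Real.toNNReal (∑ i, ∑ j, a i * C i j * a j))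


lemma IsGaussianVec.hasLaw {Ω : Type*} [MeasurableSpace Ω] {P : Measure Ω} {d : ℕ}
    {X : Ω → Fin d → ℝ} {μ : Fin d → ℝ} {C : Matrix (Fin d) (Fin d) ℝ}
    (h : IsGaussianVec P X μ C) : HasGaussianLaw X P where
  isGaussian_map := by
    refine isGaussian_of_map_eq_gaussianReal fun L => ?_
    refine ⟨_, _, Eq.trans ?_ (h.2 (fun i => L (Pi.single i 1)))⟩
    rw [Measure.map_map (by fun_prop) h.1]
    congr 1
    ext ω
    simp only [Function.comp]
    conv_lhs => rw [← Finset.univ_sum_single (X ω)]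
    rw [map_sum]
    refine Finset.sum_congr rfl fun i _ => ?_
    have : (Pi.single i (X ω i) : Fin d → ℝ) = X ω i • Pi.single i 1 := by
      rw [← Pi.single_smul]; simp
    rw [this, map_smul, smul_eq_mul, mul_comm]

lemma IsGaussianVec.mean {Ω : Type*} [MeasurableSpace Ω] {P : Measure Ω} {d : ℕ}
    {X : Ω → Fin d → ℝ} {μ : Fin d → ℝ} {C : Matrix (Fin d) (Fin d) ℝ}
    (h : IsGaussianVec P X μ C) (i : Fin d) : ∫ ω, X ω i ∂P = μ i := by
  have hm := h.1
  have h1 := h.2 (Pi.single i 1)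
  have h2 : ∫ t, t ∂(Measure.map (fun ω => ∑ k, (Pi.single i 1 : Fin d → ℝ) k * X ω k) P) = μ i := by
    rw [h1, integral_id_gaussianReal]; simp [Pi.single_apply]
  rw [integral_map (by fun_prop) (by fun_prop)] at h2
  simpa [Pi.single_apply] using h2

lemma IsGaussianVec.var {Ω : Type*} [MeasurableSpace Ω] {P : Measure Ω} {d : ℕ}
    {X : Ω → Fin d → ℝ} {μ : Fin d → ℝ} {C : Matrix (Fin d) (Fin d) ℝ}
    (h : IsGaussianVec P X μ C) (hC : C.PosSemidef) (a : Fin d → ℝ) :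
    Var[fun ω => ∑ k, a k * X ω k; P] = ∑ i, ∑ j, a i * C i j * a j := by
  have hm := h.1
  have h1 := h.2 a
  have h2 := variance_id_gaussianReal (μ := ∑ i, a i * μ i)
    (v := Real.toNNReal (∑ i, ∑ j, a i * C i j * a j))
  rw [← h1, variance_map (by fun_prop) (by fun_prop)] at h2
  rw [Function.id_comp] at h2
  rw [h2, Real.coe_toNNReal]
  have := hC.dotProduct_mulVec_nonneg a
  simpa [dotProduct, mulVec, Finset.mul_sum, mul_assoc] using this

lemma IsGaussianVec.cov {Ω : Type*} [MeasurableSpace Ω] {P : Measure Ω} [IsProbabilityMeasure P]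
    {d : ℕ}
    {X : Ω → Fin d → ℝ} {μ : Fin d → ℝ} {C : Matrix (Fin d) (Fin d) ℝ}
    (h : IsGaussianVec P X μ C) (hC : C.PosSemidef) (i j : Fin d) :
    cov[fun ω => X ω i, fun ω => X ω j; P] = C i j := by
  have hL : ∀ k, MemLp (fun ω => X ω k) 2 P := fun k =>
    (h.hasLaw.map_fun (ContinuousLinearMap.proj (R := ℝ) (φ := fun _ : Fin d => ℝ) k)).memLp_two
  have hi := h.var hC (Pi.single i 1)
  have hj := h.var hC (Pi.single j 1)
  have hij := h.var hC (Pi.single i 1 + Pi.single j 1)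
  have hs : C j i = C i j := by simpa using hC.isHermitian.apply i j
  simp only [Pi.add_apply, add_mul, mul_add, Finset.sum_add_distrib, Pi.single_apply] at hi hj hij
  simp at hi hj hij
  rw [variance_fun_add (hL i) (hL j), hi, hj, hs] at hij
  linarith

lemma integrable_four {Ω : Type*} [MeasurableSpace Ω] {P : Measure Ω}
    {f g h k : Ω → ℝ} (hf : MemLp f 4 P) (hg : MemLp g 4 P) (hh : MemLp h 4 P) (hk : MemLp k 4 P) :
    Integrable (fun ω => f ω * g ω * (h ω * k ω)) P := by
  have : ENNReal.HolderTriple 4 4 2 := ⟨by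
    have h4 : (4 : ENNReal) = 2 * 2 := by norm_num
    rw [h4, ENNReal.mul_inv (by simp) (by simp), ← mul_add, ENNReal.inv_two_add_inv_two, mul_one]⟩
  have h1 : MemLp (fun ω => f ω * g ω) 2 P := hg.mul' hf
  have h2 : MemLp (fun ω => h ω * k ω) 2 P := hk.mul' hh
  exact h1.integrable_mul h2

/-- For the denoising score matching setup with Gaussian data
`x ∼ N(μ, C_data)`, noise `w ∼ N(0, I)`, `z = (x + σw, 1)`, `y = −w/σ`,
`ν_i = E[y_i z]`, `θ_i* = C_z⁻¹ ν_i`, the SGD noise covariance matrix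
`Σ_ε^{ij}` equals `(1/σ²) (C_σ⁻¹ C_data)_{ij} C_z`. -/
theorem sgd_noise_covariance_denoising {d : ℕ}
    {Ω : Type*} [MeasurableSpace Ω] (P : Measure Ω) [IsProbabilityMeasure P]
    (μ : Fin d → ℝ) (Cdata : Matrix (Fin d) (Fin d) ℝ) (hCdata : Cdata.PosDef)
    (σ : ℝ) (hσ : 0 < σ)
    (x w : Ω → Fin d → ℝ)
    (hx : IsGaussianVec P x μ Cdata)
    (hw : IsGaussianVec P w 0 (1 : Matrix (Fin d) (Fin d) ℝ))
    (hindep : IndepFun x w P)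
    (z : Ω → Fin (d + 1) → ℝ)
    (hz : ∀ ω, z ω = Fin.snoc (fun i => x ω i + σ * w ω i) 1)
    (y : Ω → Fin d → ℝ) (hy : ∀ ω i, y ω i = -(w ω i) / σ)
    (Cz : Matrix (Fin (d + 1)) (Fin (d + 1)) ℝ)
    (hCz : ∀ a b, Cz a b = ∫ ω, z ω a * z ω b ∂P)
    (ν : Fin d → Fin (d + 1) → ℝ) (hν : ∀ i a, ν i a = ∫ ω, y ω i * z ω a ∂P)
    (θs : Fin d → Fin (d + 1) → ℝ) (hθs : ∀ i, θs i = Cz⁻¹ *ᵥ ν i)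
    (Cσ : Matrix (Fin d) (Fin d) ℝ)
    (hCσ : Cσ = Cdata + (σ ^ 2) • (1 : Matrix (Fin d) (Fin d) ℝ)) :
    ∀ (i j : Fin d) (a b : Fin (d + 1)),
      (∫ ω, y ω i * y ω j * (z ω a * z ω b) ∂P)
        + (∫ ω, (∑ c, z ω c * θs i c) * (∑ c, z ω c * θs j c) * (z ω a * z ω b) ∂P)
        - (∫ ω, y ω i * (∑ c, θs j c * z ω c) * (z ω a * z ω b) ∂P)
        - (∫ ω, y ω j * (∑ c, θs i c * z ω c) * (z ω a * z ω b) ∂P)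
      = (1 / σ ^ 2) * (Cσ⁻¹ * Cdata) i j * Cz a b := by
  have hσ0 : σ ≠ 0 := hσ.ne'
  have hCσpd : Cσ.PosDef := hCσ ▸ hCdata.add (Matrix.PosDef.one.smul (by positivity))
  have hdet : IsUnit Cσ.det := hCσpd.det_pos.ne'.isUnit
  have hsymm : ∀ k l, Cσ k l = Cσ l k := fun k l => by simpa using hCσpd.isHermitian.apply l k
  set S := Cσ⁻¹ with hS
  have hSC : S * Cσ = 1 := Matrix.nonsing_inv_mul _ hdet
  have hxl := hx.hasLaw
  have hwl := hw.hasLaw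
  have hxw := hindep.hasGaussianLaw hxl hwl
  set u : Fin d → Ω → ℝ := fun k ω => x ω k + σ * w ω k with hu
  set r0 : Fin d → Ω → ℝ := fun i ω => -(1 / σ) * w ω i + ∑ k, S i k * u k ω with hr0
  -- joint law
  have hjoint : HasGaussianLaw (fun ω => (fun i => r0 i ω, fun k => u k ω)) P := by
    let px : Fin d → ((Fin d → ℝ) × (Fin d → ℝ)) →L[ℝ] ℝ := fun k =>
      (ContinuousLinearMap.proj (R := ℝ) (φ := fun _ : Fin d => ℝ) k).comp
        (ContinuousLinearMap.fst ℝ _ _)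
    let pw : Fin d → ((Fin d → ℝ) × (Fin d → ℝ)) →L[ℝ] ℝ := fun k =>
      (ContinuousLinearMap.proj (R := ℝ) (φ := fun _ : Fin d => ℝ) k).comp
        (ContinuousLinearMap.snd ℝ _ _)
    let pu : Fin d → ((Fin d → ℝ) × (Fin d → ℝ)) →L[ℝ] ℝ := fun k => px k + σ • pw k
    let pr : Fin d → ((Fin d → ℝ) × (Fin d → ℝ)) →L[ℝ] ℝ := fun i =>
      (-(1 / σ)) • pw i + ∑ k, S i k • pu k
    have := hxw.map_fun ((ContinuousLinearMap.pi pr).prod (ContinuousLinearMap.pi pu))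
    convert! this using 1
    funext ω
    ext k <;> simp [pr, pu, px, pw, hr0, hu, mul_add]
  have hx4 : ∀ (k) (p : ENNReal), p ≠ ⊤ → MemLp (fun ω => x ω k) p P := fun k p hp =>
    (hxl.map_fun (ContinuousLinearMap.proj (R := ℝ) (φ := fun _ : Fin d => ℝ) k)).memLp hp
  have hw4 : ∀ (k) (p : ENNReal), p ≠ ⊤ → MemLp (fun ω => w ω k) p P := fun k p hp =>
    (hwl.map_fun (ContinuousLinearMap.proj (R := ℝ) (φ := fun _ : Fin d => ℝ) k)).memLp hp
  have hu4 : ∀ (k) (p : ENNReal), p ≠ ⊤ → MemLp (u k) p P := fun k p hp =>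
    (hx4 k p hp).add ((hw4 k p hp).const_mul σ)
  have hsum4 : ∀ (i) (p : ENNReal), p ≠ ⊤ → MemLp (fun ω => ∑ k, S i k * u k ω) p P :=
    fun i p hp => memLp_finsetSum _ fun k _ => (hu4 k p hp).const_mul _
  have hr4 : ∀ (k) (p : ENNReal), p ≠ ⊤ → MemLp (r0 k) p P := fun k p hp =>
    ((hw4 k p hp).const_mul _).add (hsum4 k p hp)
  have two : (2 : ENNReal) ≠ ⊤ := by simp
  -- covariances
  have cxx := hx.cov hCdata.posSemidef
  have cww := hw.cov Matrix.PosSemidef.one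
  have cxw : ∀ k l, cov[fun ω => x ω k, fun ω => w ω l; P] = 0 := fun k l =>
    (hindep.comp (φ := fun v : Fin d → ℝ => v k) (ψ := fun v : Fin d → ℝ => v l)
      (by fun_prop) (by fun_prop)).covariance_eq_zero (hx4 k 2 two) (hw4 l 2 two)
  have cwx : ∀ k l, cov[fun ω => w ω k, fun ω => x ω l; P] = 0 := fun k l => by
    rw [covariance_comm]; exact cxw l k
  have cwu : ∀ k l, cov[fun ω => w ω k, u l; P] = σ * (1 : Matrix (Fin d) (Fin d) ℝ) k l := by
    intro k l
    have : u l = (fun ω => x ω l) + (fun ω => σ * w ω l) := rfl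
    rw [this, covariance_add_right (hw4 k 2 two) (hx4 l 2 two) ((hw4 l 2 two).const_mul _),
      covariance_const_mul_right, cww, cwx, zero_add]
  have cuu : ∀ k l, cov[u k, u l; P] = Cσ k l := by
    intro k l
    have : u k = (fun ω => x ω k) + (fun ω => σ * w ω k) := rfl
    rw [this, covariance_add_left (hx4 k 2 two) ((hw4 k 2 two).const_mul _) (hu4 l 2 two),
      covariance_const_mul_left, cwu]
    have : u l = (fun ω => x ω l) + (fun ω => σ * w ω l) := rfl
    rw [this, covariance_add_right (hx4 k 2 two) (hx4 l 2 two) ((hw4 l 2 two).const_mul _),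
      covariance_const_mul_right, cxx, cxw, hCσ]
    simp; ring
  have cr : ∀ (i) (f : Ω → ℝ), MemLp f 2 P → cov[r0 i, f; P] =
      -(1 / σ) * cov[fun ω => w ω i, f; P] + ∑ k, S i k * cov[u k, f; P] := by
    intro i f hf
    have : r0 i = (fun ω => -(1 / σ) * w ω i) + (fun ω => ∑ k, S i k * u k ω) := rfl
    rw [this, covariance_add_left ((hw4 i 2 two).const_mul _) (hsum4 i 2 two) hf,
      covariance_const_mul_left,
      covariance_fun_sum_left (fun k => (hu4 k 2 two).const_mul _) hf]
    simp only [covariance_const_mul_left]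
  have cru : ∀ i k, cov[r0 i, u k; P] = 0 := by
    intro i k
    rw [cr i _ (hu4 k 2 two), cwu]
    simp only [cuu]
    have := congrFun (congrFun hSC i) k
    rw [Matrix.mul_apply] at this
    rw [this]; field_simp; ring
  have crr : ∀ i j, cov[r0 i, r0 j; P] =
      1 / σ ^ 2 * (1 : Matrix (Fin d) (Fin d) ℝ) i j - S i j := by
    intro i j
    rw [covariance_comm, cr j _ (hr4 i 2 two), covariance_comm, cr i _ (hw4 j 2 two), cww]
    have h1 : ∀ k, cov[u k, fun ω => w ω j; P] = σ * (1 : Matrix (Fin d) (Fin d) ℝ) j k :=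
      fun k => by rw [covariance_comm, cwu]
    have h2 : ∀ k, cov[u k, r0 i; P] = 0 := fun k => by rw [covariance_comm, cru]
    simp only [h1, h2, Matrix.one_apply]
    by_cases hij : i = j
    · subst hij
      simp
      field_simp
      ring
    · simp [hij]
      field_simp
  have hind : IndepFun (fun ω i => r0 i ω) (fun ω k => u k ω) P :=
    hjoint.indepFun_of_covariance_eval cru
  -- means
  have ex := hx.mean
  have ew := hw.mean
  have int : ∀ {f : Ω → ℝ}, MemLp f 2 P → Integrable f P := fun h => h.integrable (by norm_num)
  have eu : ∀ k, ∫ ω, u k ω ∂P = μ k := by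
    intro k
    simp only [hu]
    rw [integral_add (int (hx4 k 2 two)) (int ((hw4 k 2 two).const_mul _)),
      integral_const_mul, ex, ew]
    simp
  set m : Fin d → ℝ := fun i => ∑ k, S i k * μ k with hm
  have er : ∀ i, ∫ ω, r0 i ω ∂P = m i := by
    intro i
    simp only [hr0]
    rw [integral_add (int ((hw4 i 2 two).const_mul _)) (int (hsum4 i 2 two)),
      integral_const_mul, ew, integral_finsetSum _ (fun k _ => int ((hu4 k 2 two).const_mul _))]
    simp [integral_const_mul, eu, hm]
  -- Cz
  have hzc : ∀ ω (k : Fin d), z ω k.castSucc = u k ω := fun ω k => by rw [hz]; simp [hu]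
  have hzl : ∀ ω, z ω (Fin.last d) = 1 := fun ω => by rw [hz]; simp
  have Cuu : ∀ k l : Fin d, Cz k.castSucc l.castSucc = Cσ k l + μ k * μ l := by
    intro k l
    have := covariance_eq_sub (hu4 k 2 two) (hu4 l 2 two)
    rw [cuu, eu, eu] at this
    rw [hCz, this]; simp [hzc]
  have Cul : ∀ k : Fin d, Cz k.castSucc (Fin.last d) = μ k := fun k => by
    rw [hCz]; simp [hzc, hzl, eu]
  have Clu : ∀ k : Fin d, Cz (Fin.last d) k.castSucc = μ k := fun k => by
    rw [hCz]; simp [hzc, hzl, eu]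
  have Cll : Cz (Fin.last d) (Fin.last d) = 1 := by rw [hCz]; simp [hzl]
  have νu : ∀ i k : Fin d, ν i k.castSucc = - (1 : Matrix (Fin d) (Fin d) ℝ) i k := by
    intro i k
    have := covariance_eq_sub (hw4 i 2 two) (hu4 k 2 two)
    rw [cwu, ew] at this
    have h2 : ∀ ω, y ω i * z ω k.castSucc = -(1 / σ) * (((fun ω => w ω i) * u k) ω) := by
      intro ω; rw [hy, hzc]; simp; ring
    rw [hν]
    simp only [h2]
    rw [integral_const_mul]
    simp only [Pi.zero_apply, zero_mul, sub_zero] at this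
    rw [← this]; field_simp
  have νl : ∀ i : Fin d, ν i (Fin.last d) = 0 := by
    intro i
    have h2 : ∀ ω, y ω i * z ω (Fin.last d) = -(1 / σ) * w ω i := by
      intro ω; rw [hy, hzl]; ring
    rw [hν]
    simp only [h2]
    rw [integral_const_mul, ew]; simp
  have hmv : ∀ (v : Fin (d + 1) → ℝ) (k : Fin d), (Cz *ᵥ v) k.castSucc =
      (Cσ *ᵥ fun l => v l.castSucc) k + μ k * ((Cz *ᵥ v) (Fin.last d)) := by
    intro v k
    simp only [mulVec, dotProduct, Fin.sum_univ_castSucc, Cuu, Cul, Clu, Cll, add_mul,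
      Finset.sum_add_distrib, mul_add, Finset.mul_sum]
    simp only [mul_assoc]; ring
  have hml : ∀ (v : Fin (d + 1) → ℝ), (Cz *ᵥ v) (Fin.last d) =
      ∑ k : Fin d, μ k * v k.castSucc + v (Fin.last d) := by
    intro v
    simp only [mulVec, dotProduct, Fin.sum_univ_castSucc, Clu, Cll, one_mul]
  have hCσu : IsUnit Cσ := (Matrix.isUnit_iff_isUnit_det _).2 hdet
  have hCzu : IsUnit Cz := by
    rw [← mulVec_injective_iff_isUnit]
    intro v v' hvv
    have h0 : Cz *ᵥ (v - v') = 0 := by rw [mulVec_sub, sub_eq_zero]; exact hvv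
    rw [← sub_eq_zero]
    generalize v - v' = t at h0 ⊢
    have hc : (fun l : Fin d => t l.castSucc) = 0 := by
      apply mulVec_injective_iff_isUnit.2 hCσu
      ext k
      have := hmv t k
      rw [h0] at this
      simpa using this.symm
    have hl := hml t
    rw [h0] at hl
    have hc' : ∀ l : Fin d, t l.castSucc = 0 := fun l => congrFun hc l
    simp [hc'] at hl
    ext a
    refine Fin.lastCases ?_ (fun l => ?_) a
    · simpa using hl.symm
    · simpa using hc' l
  have hθ : ∀ i, θs i = Fin.snoc (α := fun _ => ℝ) (fun k => - S i k) (m i) := by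
    intro i
    apply mulVec_injective_iff_isUnit.2 hCzu
    rw [hθs, mulVec_mulVec, Matrix.mul_nonsing_inv _ ((Matrix.isUnit_iff_isUnit_det _).1 hCzu),
      one_mulVec]
    set v : Fin (d + 1) → ℝ := Fin.snoc (α := fun _ => ℝ) (fun k => - S i k) (m i) with hv
    have hvl : (Cz *ᵥ v) (Fin.last d) = 0 := by
      rw [hml]
      simp [hv, hm, mul_comm]
    ext a
    refine Fin.lastCases ?_ (fun k => ?_) a
    · rw [νl, hvl]
    · rw [νu, hmv, hvl]
      have := congrFun (congrFun hSC i) k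
      rw [Matrix.mul_apply] at this
      rw [← this]
      simp only [hv, Fin.snoc_castSucc, mulVec, dotProduct, mul_zero, add_zero, mul_neg,
        Finset.sum_neg_distrib]
      congr 1
      exact Finset.sum_congr rfl fun l _ => by rw [hsymm k l, mul_comm]
  -- residual
  have hres : ∀ i ω, y ω i - ∑ c, θs i c * z ω c = r0 i ω - m i := by
    intro i ω
    rw [hy, hθ, Fin.sum_univ_castSucc]
    simp only [Fin.snoc_castSucc, Fin.snoc_last, hzc, hzl, hr0, neg_mul, Finset.sum_neg_distrib]
    ring
  have four : (4 : ENNReal) ≠ ⊤ := by simp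
  have hz4 : ∀ a, MemLp (fun ω => z ω a) 4 P := by
    intro a
    refine Fin.lastCases ?_ (fun k => ?_) a
    · simp only [hzl]; exact memLp_const 1
    · simp only [hzc]; exact hu4 k 4 four
  have hy4 : ∀ i, MemLp (fun ω => y ω i) 4 P := by
    intro i
    have : (fun ω => y ω i) = fun ω => -(1 / σ) * w ω i := by ext ω; rw [hy]; ring
    rw [this]; exact (hw4 i 4 four).const_mul _
  have ht4 : ∀ i, MemLp (fun ω => ∑ c, θs i c * z ω c) 4 P := fun i =>
    memLp_finsetSum _ fun c _ => (hz4 c).const_mul _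
  intro i j a b
  have hcomm : ∀ i ω, ∑ c, z ω c * θs i c = ∑ c, θs i c * z ω c := fun i ω =>
    Finset.sum_congr rfl fun c _ => mul_comm _ _
  simp only [hcomm]
  have I1 := integrable_four (hy4 i) (hy4 j) (hz4 a) (hz4 b)
  have I2 := integrable_four (ht4 i) (ht4 j) (hz4 a) (hz4 b)
  have I3 := integrable_four (hy4 i) (ht4 j) (hz4 a) (hz4 b)
  have I4 := integrable_four (hy4 j) (ht4 i) (hz4 a) (hz4 b)
  have I123 : Integrable (fun ω => y ω i * y ω j * (z ω a * z ω b)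
      + (∑ c, θs i c * z ω c) * (∑ c, θs j c * z ω c) * (z ω a * z ω b)
      - y ω i * (∑ c, θs j c * z ω c) * (z ω a * z ω b)) P := (I1.add I2).sub I3
  rw [← integral_add I1 I2, ← integral_sub (I1.fun_add I2) I3, ← integral_sub I123 I4]
  have hpt : ∀ ω, y ω i * y ω j * (z ω a * z ω b)
      + (∑ c, θs i c * z ω c) * (∑ c, θs j c * z ω c) * (z ω a * z ω b)
      - y ω i * (∑ c, θs j c * z ω c) * (z ω a * z ω b)
      - y ω j * (∑ c, θs i c * z ω c) * (z ω a * z ω b)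
      = ((r0 i ω - m i) * (r0 j ω - m j)) * (z ω a * z ω b) := by
    intro ω
    rw [← hres, ← hres]; ring
  simp only [hpt]
  have hind2 : IndepFun (fun ω => (r0 i ω - m i) * (r0 j ω - m j)) (fun ω => z ω a * z ω b) P := by
    have hms : ∀ a, Measurable fun v : Fin d → ℝ =>
        (Fin.snoc (α := fun _ => ℝ) v 1 : Fin (d + 1) → ℝ) a := by
      intro a
      refine Fin.lastCases ?_ (fun k => ?_) a
      · simp
      · simp only [Fin.snoc_castSucc]; fun_prop
    have := hind.comp (φ := fun v : Fin d → ℝ => (v i - m i) * (v j - m j))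
      (ψ := fun v : Fin d → ℝ => (Fin.snoc (α := fun _ => ℝ) v 1 : Fin (d + 1) → ℝ) a *
        (Fin.snoc (α := fun _ => ℝ) v 1 : Fin (d + 1) → ℝ) b)
      (by fun_prop) ((hms a).mul (hms b))
    have e : (fun ω => z ω a * z ω b) = (fun v : Fin d → ℝ =>
        (Fin.snoc (α := fun _ => ℝ) v 1 : Fin (d + 1) → ℝ) a *
        (Fin.snoc (α := fun _ => ℝ) v 1 : Fin (d + 1) → ℝ) b) ∘ fun ω k => u k ω := by
      funext ω
      simp only [hz, Function.comp, hu]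
    rw [e]
    exact this
  have hmz : ∀ a, AEStronglyMeasurable (fun ω => z ω a) P := fun a => (hz4 a).1
  have hmr : ∀ i, AEStronglyMeasurable (fun ω => r0 i ω - m i) P := fun i =>
    (hr4 i 4 four).1.sub aestronglyMeasurable_const
  rw [hind2.integral_fun_mul_eq_mul_integral ((hmr i).mul (hmr j)) ((hmz a).mul (hmz b)), ← hCz]
  have hcov : ∫ ω, (r0 i ω - m i) * (r0 j ω - m j) ∂P = cov[r0 i, r0 j; P] := by
    rw [covariance, er, er]
  rw [hcov, crr]
  congr 1
  have hCd : Cdata = Cσ - (σ ^ 2) • (1 : Matrix (Fin d) (Fin d) ℝ) := by rw [hCσ]; simp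
  rw [hCd, Matrix.mul_sub, hSC]
  simp
  field_simp
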